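/- Let (X,H,ν) be a categorical augmented rack with H cocommutative and X cocommutative. Let Y = X⊗X with the tensor-product comultiplication Δ_Y(x⊗y) = (x⁽¹⁾⊗y⁽¹⁾) ⊗ (x⁽²⁾⊗y⁽²⁾), the right H-action (x⊗y)·h = (x·h⁽¹⁾) ⊗ (y·h⁽²⁾), and ν̃(x⊗y) = ν(x)ν(y). Then the R-matrix R_Y : Y⊗Y → Y⊗Y defined by R_Y(w⊗z) = z⁽¹⁾ ⊗ (w·ν̃(z⁽²⁾)) (Sweedler notation with respect to Δ_Y) satisfies the Yang–Baxter equation (R_Y⊗1)∘(1⊗R_Y)∘(R_Y⊗1) = (1⊗R_Y)∘(R_Y⊗1)∘(1⊗R_Y) on Y⊗Y⊗Y. -/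

import Mathlib

open TensorProduct

variable {k : Type*} [CommRing k] {H : Type*} [Ring H] [HopfAlgebra k H]
variable {X : Type*} [AddCommGroup X] [Module k X] [Coalgebra k X]

/-- `sandwich a` is the linear map `H ⊗ H → H` sending `g⁽¹⁾ ⊗ g⁽²⁾` to `S(g⁽¹⁾) * a * g⁽²⁾`. -/
noncomputable def sandwich (a : H) : H ⊗[k] H →ₗ[k] H :=
  LinearMap.mul' k H ∘ₗ
    LinearMap.rTensor H (LinearMap.mulRight k a ∘ₗ HopfAlgebra.antipode (R := k))

/-- The doubled action on `Y = X ⊗ X`: `(x ⊗ y) · h = (x · h⁽¹⁾) ⊗ (y · h⁽²⁾)`. -/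
noncomputable def doubleAct (act : X ⊗[k] H →ₗ[k] X) :
    (X ⊗[k] X) ⊗[k] H →ₗ[k] X ⊗[k] X :=
  TensorProduct.map act act ∘ₗ
    (TensorProduct.tensorTensorTensorComm k X X H H).toLinearMap ∘ₗ
    LinearMap.lTensor (X ⊗[k] X) (Coalgebra.comul (R := k))

/-- The doubled augmentation `ν̃ : X ⊗ X → H`, `ν̃(x ⊗ y) = ν(x) ν(y)`. -/
noncomputable def doubleNu (ν : X →ₗ[k] H) : X ⊗[k] X →ₗ[k] H :=
  LinearMap.mul' k H ∘ₗ TensorProduct.map ν ν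

/-- The tensor-product comultiplication on `Y = X ⊗ X`:
`Δ_Y(x ⊗ y) = (x⁽¹⁾ ⊗ y⁽¹⁾) ⊗ (x⁽²⁾ ⊗ y⁽²⁾)`. -/
noncomputable def comulY (k : Type*) [CommRing k]
    (X : Type*) [AddCommGroup X] [Module k X] [Coalgebra k X] :
    X ⊗[k] X →ₗ[k] (X ⊗[k] X) ⊗[k] (X ⊗[k] X) :=
  (TensorProduct.tensorTensorTensorComm k X X X X).toLinearMap ∘ₗ
    TensorProduct.map (Coalgebra.comul (R := k)) (Coalgebra.comul (R := k))

/-- The R-matrix `R_Y(w ⊗ z) = z⁽¹⁾ ⊗ (w · ν̃(z⁽²⁾))` on `Y ⊗ Y`, `Y = X ⊗ X`. -/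
noncomputable def doubleR (act : X ⊗[k] H →ₗ[k] X) (ν : X →ₗ[k] H) :
    (X ⊗[k] X) ⊗[k] (X ⊗[k] X) →ₗ[k] (X ⊗[k] X) ⊗[k] (X ⊗[k] X) :=
  LinearMap.lTensor (X ⊗[k] X) (doubleAct act ∘ₗ LinearMap.lTensor (X ⊗[k] X) (doubleNu ν)) ∘ₗ
    (TensorProduct.leftComm k (X ⊗[k] X) (X ⊗[k] X) (X ⊗[k] X)).toLinearMap ∘ₗ
    LinearMap.lTensor (X ⊗[k] X) (comulY k X)

/-- `R ⊗ 1` as a map on `M ⊗ (M ⊗ M)`. -/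
noncomputable def rOne (M : Type*) [AddCommGroup M] [Module k M]
    (R : M ⊗[k] M →ₗ[k] M ⊗[k] M) : M ⊗[k] (M ⊗[k] M) →ₗ[k] M ⊗[k] (M ⊗[k] M) :=
  (TensorProduct.assoc k M M M).toLinearMap ∘ₗ LinearMap.rTensor M R ∘ₗ
    (TensorProduct.assoc k M M M).symm.toLinearMap

section HopfIdentities

open Coalgebra

/-- `h⁽¹⁾ S(h⁽²⁾) v h⁽³⁾ = v h`. -/
lemma mul_sandwich_comul (v h : H) :
    LinearMap.mul' k H (LinearMap.lTensor H (sandwich (k := k) v ∘ₗ comul (R := k))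
      (comul (R := k) h)) = v * h := by
  have key (t : H ⊗[k] H) :
      LinearMap.mul' k H (LinearMap.lTensor H (sandwich (k := k) v)
        (TensorProduct.assoc k H H H (LinearMap.rTensor H (comul (R := k)) t))) =
      v * TensorProduct.lid k H (LinearMap.rTensor H (counit (R := k)) t) := by
    induction t with
    | zero => simp
    | add x y hx hy => simp only [map_add, hx, hy, mul_add]
    | tmul a b =>
      have inner (s : H ⊗[k] H) :
          LinearMap.mul' k H (LinearMap.lTensor H (sandwich (k := k) v)
            (TensorProduct.assoc k H H H (s ⊗ₜ b))) =
          LinearMap.mul' k H (LinearMap.lTensor H (HopfAlgebra.antipode k) s) * v * b := by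
        induction s with
        | zero => simp
        | add x y hx hy => simp only [map_add, add_tmul, hx, hy, add_mul]
        | tmul c d => simp [sandwich, mul_assoc]
      rw [LinearMap.rTensor_tmul, inner, HopfAlgebra.mul_antipode_lTensor_comul_apply]
      simp [Algebra.algebraMap_eq_smul_one]
  rw [LinearMap.lTensor_comp, LinearMap.comp_apply, ← coassoc_apply, key, rTensor_counit_comul]
  simp

/-- The adjoint action is multiplicative: `S(h⁽¹⁾) a h⁽²⁾ S(h⁽³⁾) b h⁽⁴⁾ = S(h⁽¹⁾) a b h⁽²⁾`. -/
lemma sandwich_mul_comul (a b h : H) :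
    LinearMap.mul' k H (TensorProduct.map (sandwich (k := k) a ∘ₗ comul (R := k))
      (sandwich (k := k) b ∘ₗ comul (R := k)) (comul (R := k) h)) =
    sandwich (k := k) (a * b) (comul (R := k) h) := by
  have key (G : H →ₗ[k] H) (t : H ⊗[k] H) :
      LinearMap.mul' k H (TensorProduct.map (sandwich (k := k) a ∘ₗ comul (R := k)) G t) =
      LinearMap.mul' k H (TensorProduct.map
        (LinearMap.mulRight k a ∘ₗ HopfAlgebra.antipode (R := k))
        (LinearMap.mul' k H ∘ₗ LinearMap.lTensor H G)
        (TensorProduct.assoc k H H H (LinearMap.rTensor H (comul (R := k)) t))) := by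
    induction t with
    | zero => simp
    | add x y hx hy => simp only [map_add, hx, hy]
    | tmul p q =>
      simp only [TensorProduct.map_tmul, LinearMap.rTensor_tmul, LinearMap.comp_apply]
      generalize comul (R := k) p = s
      induction s with
      | zero => simp
      | add x y hx hy => simp only [map_add, add_tmul, hx, hy]
      | tmul c d => simp [sandwich, mul_assoc]
  have cancel : LinearMap.mul' k H ∘ₗ LinearMap.lTensor H (sandwich (k := k) b ∘ₗ comul (R := k))
      ∘ₗ comul (R := k) = LinearMap.mulLeft k b :=
    LinearMap.ext fun x => mul_sandwich_comul b x
  rw [key, coassoc_apply, ← LinearMap.comp_apply (TensorProduct.map _ _), LinearMap.map_comp_lTensor,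
    LinearMap.comp_assoc, cancel]
  generalize comul (R := k) h = s
  induction s with
  | zero => simp
  | add x y hx hy => simp only [map_add, hx, hy]
  | tmul c d => simp [sandwich, mul_assoc]

/-- In a cocommutative coalgebra `h⁽²⁾ ⊗ h⁽¹⁾ ⊗ h⁽³⁾ = h⁽¹⁾ ⊗ h⁽²⁾ ⊗ h⁽³⁾`. -/
lemma leftComm_lTensor_comul_comul {C : Type*} [AddCommGroup C] [Module k C] [Coalgebra k C]
    [IsCocomm k C] (h : C) :
    TensorProduct.leftComm k C C C (LinearMap.lTensor C (comul (R := k)) (comul (R := k) h)) =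
      LinearMap.lTensor C (comul (R := k)) (comul (R := k) h) := by
  rw [← coassoc_apply]
  generalize comul (R := k) h = t
  induction t with
  | zero => simp
  | add x y hx hy => simp only [map_add, hx, hy]
  | tmul a b =>
    have inner (s : C ⊗[k] C) :
        TensorProduct.leftComm k C C C (TensorProduct.assoc k C C C (s ⊗ₜ b)) =
        TensorProduct.assoc k C C C (TensorProduct.comm k C C s ⊗ₜ b) := by
      induction s with
      | zero => simp
      | add x y hx hy => simp only [map_add, add_tmul, hx, hy]
      | tmul c d => simp
    rw [LinearMap.rTensor_tmul, inner, comm_comul]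

end HopfIdentities

section AugmentedRack

open Coalgebra

variable {Y : Type*} [AddCommGroup Y] [Module k Y]

/-- The diagonal action on `Y ⊗ Y`: `(x ⊗ y) · h = (x · h⁽¹⁾) ⊗ (y · h⁽²⁾)`. -/
noncomputable def diagAct (act : Y ⊗[k] H →ₗ[k] Y) : (Y ⊗[k] Y) ⊗[k] H →ₗ[k] Y ⊗[k] Y :=
  TensorProduct.map act act ∘ₗ
    (TensorProduct.tensorTensorTensorComm k Y Y H H).toLinearMap ∘ₗ
    LinearMap.lTensor (Y ⊗[k] Y) (comul (R := k))

lemma diagAct_tmul (act : Y ⊗[k] H →ₗ[k] Y) (x y : Y) (h : H) :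
    diagAct act ((x ⊗ₜ y) ⊗ₜ h) =
      TensorProduct.map (act ∘ₗ TensorProduct.mk k Y H x) (act ∘ₗ TensorProduct.mk k Y H y)
        (comul (R := k) h) := by
  simp only [diagAct, LinearMap.comp_apply, LinearMap.lTensor_tmul, LinearEquiv.coe_coe]
  generalize comul (R := k) h = t
  induction t with
  | zero => simp
  | add x y hx hy => simp only [map_add, tmul_add, hx, hy]
  | tmul a b => simp

variable [Coalgebra k Y]

/-- The R-matrix `w ⊗ z ↦ z⁽¹⁾ ⊗ (w · ν(z⁽²⁾))` of an augmented rack. -/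
noncomputable def rackR (act : Y ⊗[k] H →ₗ[k] Y) (ν : Y →ₗ[k] H) :
    Y ⊗[k] Y →ₗ[k] Y ⊗[k] Y :=
  LinearMap.lTensor Y (act ∘ₗ LinearMap.lTensor Y ν) ∘ₗ
    (TensorProduct.leftComm k Y Y Y).toLinearMap ∘ₗ LinearMap.lTensor Y (comul (R := k))

lemma rackR_tmul (act : Y ⊗[k] H →ₗ[k] Y) (ν : Y →ₗ[k] H) (w z : Y) :
    rackR act ν (w ⊗ₜ z) =
      LinearMap.lTensor Y (act ∘ₗ TensorProduct.mk k Y H w ∘ₗ ν) (comul (R := k) z) := by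
  simp only [rackR, LinearMap.comp_apply, LinearMap.lTensor_tmul, LinearEquiv.coe_coe]
  generalize comul (R := k) z = t
  induction t with
  | zero => simp
  | add x y hx hy => simp only [map_add, tmul_add, hx, hy]
  | tmul a b => simp

/-- The R-matrix of an augmented rack over a cocommutative Hopf algebra is equivariant. -/
lemma rackR_diagAct [IsCocomm k H] (act : Y ⊗[k] H →ₗ[k] Y)
    (hact_mul : ∀ (x : Y) (g h : H), act (act (x ⊗ₜ g) ⊗ₜ h) = act (x ⊗ₜ (g * h)))
    (hcompat : ∀ (y : Y) (g : H), comul (R := k) (act (y ⊗ₜ g)) =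
      TensorProduct.map act act (TensorProduct.tensorTensorTensorComm k Y Y H H
        (comul (R := k) y ⊗ₜ comul (R := k) g)))
    (ν : Y →ₗ[k] H)
    (hν_aug : ∀ (x : Y) (g : H), ν (act (x ⊗ₜ g)) = sandwich (ν x) (comul (R := k) g))
    (p : Y ⊗[k] Y) (g : H) :
    rackR act ν (diagAct act (p ⊗ₜ g)) = diagAct act (rackR act ν p ⊗ₜ g) := by
  induction p with
  | zero => simp
  | add x y hx hy => simp only [map_add, add_tmul, hx, hy]
  | tmul w z =>
    let F (ζ : Y ⊗[k] Y) : H ⊗[k] (H ⊗[k] H) →ₗ[k] Y ⊗[k] Y :=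
      LinearMap.lTensor Y (act ∘ₗ LinearMap.lTensor Y ν) ∘ₗ
        (TensorProduct.leftComm k Y Y Y).toLinearMap ∘ₗ
        TensorProduct.map (act ∘ₗ TensorProduct.mk k Y H w)
          (TensorProduct.map act act ∘ₗ
            (TensorProduct.tensorTensorTensorComm k Y Y H H).toLinearMap ∘ₗ
            TensorProduct.mk k (Y ⊗[k] Y) (H ⊗[k] H) ζ)
    have expand (t : H ⊗[k] H) :
        rackR act ν (TensorProduct.map (act ∘ₗ TensorProduct.mk k Y H w)
          (act ∘ₗ TensorProduct.mk k Y H z) t) =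
        F (comul (R := k) z) (LinearMap.lTensor H (comul (R := k)) t) := by
      induction t with
      | zero => simp
      | add x y hx hy => simp only [map_add, hx, hy]
      | tmul p q => simp [F, rackR, hcompat]
    have main (ζ : Y ⊗[k] Y) :
        F ζ (LinearMap.lTensor H (comul (R := k)) (comul (R := k) g)) =
        diagAct act
          (LinearMap.lTensor Y (act ∘ₗ TensorProduct.mk k Y H w ∘ₗ ν) ζ ⊗ₜ g) := by
      induction ζ with
      | zero =>
        simp only [map_zero, zero_tmul]
        simp [F]
      | add x y hx hy =>
        have hF : F (x + y) = F x + F y := by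
          simp only [F, map_add, LinearMap.comp_add, TensorProduct.map_add_right]
        rw [hF, LinearMap.add_apply, hx, hy]
        simp only [map_add, add_tmul]
      | tmul u v =>
        have hF : F (u ⊗ₜ v) = TensorProduct.map (act ∘ₗ TensorProduct.mk k Y H u)
            (act ∘ₗ TensorProduct.mk k Y H w ∘ₗ LinearMap.mul' k H ∘ₗ
              LinearMap.lTensor H (sandwich (k := k) (ν v) ∘ₗ comul (R := k))) ∘ₗ
            (TensorProduct.leftComm k H H H).toLinearMap := by
          ext p r s
          simp [F, hact_mul, hν_aug]
        have cancel : LinearMap.mul' k H ∘ₗ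
            LinearMap.lTensor H (sandwich (k := k) (ν v) ∘ₗ comul (R := k)) ∘ₗ
            comul (R := k) = LinearMap.mulLeft k (ν v) :=
          LinearMap.ext fun x => mul_sandwich_comul (ν v) x
        rw [hF, LinearMap.comp_apply, LinearEquiv.coe_coe, leftComm_lTensor_comul_comul,
          ← LinearMap.comp_apply (TensorProduct.map _ _), LinearMap.map_comp_lTensor]
        simp only [LinearMap.comp_assoc, cancel]
        rw [LinearMap.lTensor_tmul, diagAct_tmul]
        congr 2
        ext x
        simp [hact_mul]
    rw [diagAct_tmul, expand, main, rackR_tmul]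

/-- `R₁ R₂` slides a tensor `p` past `c`: `p ⊗ c ↦ c⁽¹⁾ ⊗ (p · ν(c⁽²⁾))`. -/
lemma rOne_lTensor_rackR (act : Y ⊗[k] H →ₗ[k] Y) (ν : Y →ₗ[k] H)
    (hν_comul : comul (R := k) ∘ₗ ν = TensorProduct.map ν ν ∘ₗ comul (R := k))
    (p : Y ⊗[k] Y) (c : Y) :
    rOne Y (rackR act ν) (LinearMap.lTensor Y (rackR act ν)
      (TensorProduct.assoc k Y Y Y (p ⊗ₜ c))) =
    LinearMap.lTensor Y (diagAct act ∘ₗ TensorProduct.mk k (Y ⊗[k] Y) H p ∘ₗ ν)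
      (comul (R := k) c) := by
  induction p with
  | zero => simp
  | add x y hx hy =>
    simp only [map_add, add_tmul, hx, hy, LinearMap.add_comp, LinearMap.comp_add,
      LinearMap.lTensor_add, LinearMap.add_apply]
  | tmul u v =>
    let U : Y →ₗ[k] Y := act ∘ₗ TensorProduct.mk k Y H u ∘ₗ ν
    let V : Y →ₗ[k] Y := act ∘ₗ TensorProduct.mk k Y H v ∘ₗ ν
    have expand (t : Y ⊗[k] Y) :
        rOne Y (rackR act ν) (u ⊗ₜ LinearMap.lTensor Y V t) =
        LinearMap.lTensor Y (TensorProduct.map U V)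
          (TensorProduct.assoc k Y Y Y (LinearMap.rTensor Y (comul (R := k)) t)) := by
      induction t with
      | zero => simp
      | add x y hx hy => simp only [map_add, tmul_add, hx, hy]
      | tmul a b =>
        simp only [rOne, LinearMap.comp_apply, LinearMap.lTensor_tmul, LinearEquiv.coe_coe,
          TensorProduct.assoc_symm_tmul, LinearMap.rTensor_tmul, rackR_tmul]
        generalize comul (R := k) a = s
        induction s with
        | zero => simp
        | add x y hx hy => simp only [map_add, add_tmul, hx, hy]
        | tmul c d => simp [U]
    have hdiag : TensorProduct.map U V ∘ₗ comul (R := k) =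
        diagAct act ∘ₗ TensorProduct.mk k (Y ⊗[k] Y) H (u ⊗ₜ v) ∘ₗ ν := by
      ext x
      have := LinearMap.congr_fun hν_comul x
      simp only [LinearMap.comp_apply] at this
      simp only [LinearMap.comp_apply, TensorProduct.mk_apply, diagAct_tmul, this]
      rw [← LinearMap.comp_apply _ (TensorProduct.map ν ν), ← TensorProduct.map_comp]
      rfl
    rw [TensorProduct.assoc_tmul, LinearMap.lTensor_tmul, rackR_tmul, expand, coassoc_apply,
      ← LinearMap.comp_apply, ← LinearMap.lTensor_comp, hdiag]

/-- The R-matrix of an augmented rack over a cocommutative Hopf algebra satisfies the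
Yang–Baxter equation. -/
theorem rackR_yang_baxter [IsCocomm k H] (act : Y ⊗[k] H →ₗ[k] Y)
    (hact_mul : ∀ (x : Y) (g h : H), act (act (x ⊗ₜ g) ⊗ₜ h) = act (x ⊗ₜ (g * h)))
    (hcompat : ∀ (y : Y) (g : H), comul (R := k) (act (y ⊗ₜ g)) =
      TensorProduct.map act act (TensorProduct.tensorTensorTensorComm k Y Y H H
        (comul (R := k) y ⊗ₜ comul (R := k) g)))
    (ν : Y →ₗ[k] H)
    (hν_comul : comul (R := k) ∘ₗ ν = TensorProduct.map ν ν ∘ₗ comul (R := k))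
    (hν_aug : ∀ (x : Y) (g : H), ν (act (x ⊗ₜ g)) = sandwich (ν x) (comul (R := k) g)) :
    rOne Y (rackR act ν) ∘ₗ LinearMap.lTensor Y (rackR act ν) ∘ₗ rOne Y (rackR act ν) =
      LinearMap.lTensor Y (rackR act ν) ∘ₗ rOne Y (rackR act ν) ∘ₗ
        LinearMap.lTensor Y (rackR act ν) := by
  refine TensorProduct.ext' fun a q => ?_
  induction q with
  | zero => simp
  | add x y hx hy => simp only [map_add, tmul_add, hx, hy]
  | tmul b c =>
    have h₁ : rOne Y (rackR act ν) (a ⊗ₜ (b ⊗ₜ c)) =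
        TensorProduct.assoc k Y Y Y (rackR act ν (a ⊗ₜ b) ⊗ₜ c) := by
      simp [rOne]
    have h₂ := rOne_lTensor_rackR act ν hν_comul (a ⊗ₜ b) c
    rw [TensorProduct.assoc_tmul] at h₂
    rw [LinearMap.comp_apply, LinearMap.comp_apply, LinearMap.comp_apply, LinearMap.comp_apply,
      h₁, rOne_lTensor_rackR act ν hν_comul, h₂, ← LinearMap.comp_apply (LinearMap.lTensor Y (rackR act ν)),
      ← LinearMap.lTensor_comp]
    congr 2
    ext x
    simp [rackR_diagAct act hact_mul hcompat ν hν_aug]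

end AugmentedRack

section Doubling

open Coalgebra

omit [Coalgebra k X] in
lemma doubleAct_eq_diagAct (act : X ⊗[k] H →ₗ[k] X) : doubleAct act = diagAct act := rfl

lemma doubleR_eq_rackR (act : X ⊗[k] H →ₗ[k] X) (ν : X →ₗ[k] H) :
    doubleR act ν = rackR (doubleAct act) (doubleNu ν) := rfl

omit [Coalgebra k X] in
lemma doubleAct_doubleAct (act : X ⊗[k] H →ₗ[k] X)
    (hact_mul : ∀ (x : X) (g h : H), act (act (x ⊗ₜ g) ⊗ₜ h) = act (x ⊗ₜ (g * h)))
    (y : X ⊗[k] X) (g h : H) :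
    doubleAct act (doubleAct act (y ⊗ₜ g) ⊗ₜ h) = doubleAct act (y ⊗ₜ (g * h)) := by
  induction y with
  | zero => simp
  | add x y hx hy => simp only [map_add, add_tmul, hx, hy]
  | tmul a b =>
    simp only [doubleAct, LinearMap.comp_apply, LinearMap.lTensor_tmul, Bialgebra.comul_mul]
    generalize comul (R := k) g = s
    generalize comul (R := k) h = t
    induction s with
    | zero => simp
    | add x y hx hy => simp only [map_add, add_tmul, tmul_add, add_mul, hx, hy]
    | tmul g₁ g₂ =>
      induction t with
      | zero => simp
      | add x y hx hy => simp only [map_add, tmul_add, mul_add, hx, hy]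
      | tmul h₁ h₂ => simp [hact_mul]

lemma comul_doubleAct [IsCocomm k H] (act : X ⊗[k] H →ₗ[k] X)
    (hcompat : comul (R := k) ∘ₗ act =
      TensorProduct.map act act ∘ₗ (TensorProduct.tensorTensorTensorComm k X X H H).toLinearMap
        ∘ₗ TensorProduct.map (comul (R := k)) (comul (R := k)))
    (y : X ⊗[k] X) (g : H) :
    comul (R := k) (doubleAct act (y ⊗ₜ g)) =
      TensorProduct.map (doubleAct act) (doubleAct act)
        (TensorProduct.tensorTensorTensorComm k (X ⊗[k] X) (X ⊗[k] X) H H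
          (comul (R := k) y ⊗ₜ comul (R := k) g)) := by
  have hc (x : X) (h : H) := LinearMap.congr_fun hcompat (x ⊗ₜ h)
  simp only [LinearMap.comp_apply, TensorProduct.map_tmul, LinearEquiv.coe_coe] at hc
  induction y with
  | zero => simp
  | add x y hx hy => simp only [map_add, add_tmul, hx, hy]
  | tmul a b =>
    let A (α : X ⊗[k] X) : H ⊗[k] H →ₗ[k] X ⊗[k] X := TensorProduct.map act act ∘ₗ
      (TensorProduct.tensorTensorTensorComm k X X H H).toLinearMap ∘ₗ
      TensorProduct.mk k (X ⊗[k] X) (H ⊗[k] H) α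
    have lhs (t : H ⊗[k] H) :
        comul (R := k) (TensorProduct.map (act ∘ₗ TensorProduct.mk k X H a)
          (act ∘ₗ TensorProduct.mk k X H b) t) =
        TensorProduct.tensorTensorTensorComm k X X X X (TensorProduct.map
          (A (comul (R := k) a)) (A (comul (R := k) b))
          (TensorProduct.map (comul (R := k)) (comul (R := k)) t)) := by
      induction t with
      | zero => simp
      | add x y hx hy => simp only [map_add, hx, hy]
      | tmul p q =>
        simp only [TensorProduct.map_tmul, LinearMap.comp_apply, TensorProduct.mk_apply,
          TensorProduct.comul_tmul, hc, A, LinearEquiv.coe_coe]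
        rfl
    have swap : TensorProduct.map (comul (R := k)) (comul (R := k)) (comul (R := k) g) =
        TensorProduct.tensorTensorTensorComm k H H H H
          (TensorProduct.map (comul (R := k)) (comul (R := k)) (comul (R := k) g)) :=
      LinearMap.congr_fun (comulCoalgHom k H).map_comp_comul g
    have rhs (α β : X ⊗[k] X) (t : H ⊗[k] H) :
        TensorProduct.tensorTensorTensorComm k X X X X (TensorProduct.map (A α) (A β)
          (TensorProduct.tensorTensorTensorComm k H H H H
            (TensorProduct.map (comul (R := k)) (comul (R := k)) t))) =
        TensorProduct.map (doubleAct act) (doubleAct act)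
          (TensorProduct.tensorTensorTensorComm k (X ⊗[k] X) (X ⊗[k] X) H H
            (TensorProduct.tensorTensorTensorComm k X X X X (α ⊗ₜ β) ⊗ₜ t)) := by
      induction t with
      | zero => simp
      | add x y hx hy => simp only [map_add, tmul_add, hx, hy]
      | tmul p q =>
        have hA (x y : X ⊗[k] X) : A (x + y) = A x + A y := by
          simp only [A, map_add, LinearMap.comp_add]
        have hA0 : A 0 = 0 := by simp [A]
        induction α with
        | zero => simp [hA0]
        | add x y hx hy =>
          simp only [hA, TensorProduct.map_add_left, LinearMap.add_apply, map_add, add_tmul, hx, hy]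
        | tmul a₁ a₂ =>
          induction β with
          | zero => simp [hA0]
          | add x y hx hy =>
            simp only [hA, TensorProduct.map_add_right, LinearMap.add_apply, map_add, add_tmul,
              tmul_add, hx, hy]
          | tmul b₁ b₂ =>
            simp only [TensorProduct.map_tmul, TensorProduct.tensorTensorTensorComm_tmul,
              doubleAct_eq_diagAct, diagAct_tmul]
            generalize comul (R := k) p = s
            generalize comul (R := k) q = r
            induction s with
            | zero => simp
            | add x y hx hy => simp only [map_add, add_tmul, hx, hy]
            | tmul p₁ p₂ =>
              induction r with
              | zero => simp
              | add x y hx hy => simp only [map_add, tmul_add, hx, hy]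
              | tmul q₁ q₂ => simp [A]
    rw [doubleAct_eq_diagAct, diagAct_tmul, lhs, swap, rhs]
    rfl

lemma comul_comp_doubleNu (ν : X →ₗ[k] H)
    (hν_comul : comul (R := k) ∘ₗ ν = TensorProduct.map ν ν ∘ₗ comul (R := k)) :
    comul (R := k) ∘ₗ doubleNu ν =
      TensorProduct.map (doubleNu ν) (doubleNu ν) ∘ₗ comul (R := k) := by
  have hc (x : X) := LinearMap.congr_fun hν_comul x
  simp only [LinearMap.comp_apply] at hc
  refine TensorProduct.ext' fun a b => ?_
  simp only [LinearMap.comp_apply, TensorProduct.comul_tmul, doubleNu, TensorProduct.map_tmul,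
    LinearMap.mul'_apply, Bialgebra.comul_mul, hc]
  generalize comul (R := k) a = s
  generalize comul (R := k) b = t
  induction s with
  | zero => simp
  | add x y hx hy => simp only [map_add, add_tmul, add_mul, hx, hy]
  | tmul a₁ a₂ =>
    induction t with
    | zero => simp
    | add x y hx hy => simp only [map_add, tmul_add, mul_add, hx, hy]
    | tmul b₁ b₂ => simp

omit [Coalgebra k X] in
lemma doubleNu_doubleAct (act : X ⊗[k] H →ₗ[k] X) (ν : X →ₗ[k] H)
    (hν_aug : ∀ (x : X) (g : H), ν (act (x ⊗ₜ g)) = sandwich (ν x) (comul (R := k) g))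
    (y : X ⊗[k] X) (g : H) :
    doubleNu ν (doubleAct act (y ⊗ₜ g)) = sandwich (doubleNu ν y) (comul (R := k) g) := by
  have sandwich_add (a b : H) :
      sandwich (k := k) (a + b) = sandwich (k := k) a + sandwich (k := k) b := by
    ext; simp [sandwich, mul_add, add_mul]
  induction y with
  | zero =>
    have : sandwich (k := k) (0 : H) = 0 := by ext; simp [sandwich]
    simp [this]
  | add x y hx hy => simp only [map_add, add_tmul, hx, hy, sandwich_add, LinearMap.add_apply]
  | tmul a b =>
    rw [doubleAct_eq_diagAct, diagAct_tmul]
    simp only [doubleNu, LinearMap.comp_apply, TensorProduct.map_tmul, LinearMap.mul'_apply]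
    rw [← sandwich_mul_comul, ← LinearMap.comp_apply (TensorProduct.map ν ν),
      ← TensorProduct.map_comp]
    congr 3 <;> ext x <;> simp [hν_aug]

end Doubling

/-- for a categorical augmented rack `(X, H, ν)` with `H` and `X`
cocommutative, the doubled R-matrix `R_Y(w⊗z) = z⁽¹⁾ ⊗ (w·ν̃(z⁽²⁾))` on `Y = X ⊗ X`
satisfies the Yang–Baxter equation. -/
theorem doubled_R_matrix_yang_baxter
    (hcocommH : ∀ g : H, (TensorProduct.comm k H H) (Coalgebra.comul (R := k) g) =
      Coalgebra.comul (R := k) g)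
    (hcocommX : ∀ x : X, (TensorProduct.comm k X X) (Coalgebra.comul (R := k) x) =
      Coalgebra.comul (R := k) x)
    (act : X ⊗[k] H →ₗ[k] X)
    (hact_one : ∀ x : X, act (x ⊗ₜ (1 : H)) = x)
    (hact_mul : ∀ (x : X) (g h : H), act (act (x ⊗ₜ g) ⊗ₜ h) = act (x ⊗ₜ (g * h)))
    (hcompat : (Coalgebra.comul (R := k) (A := X)) ∘ₗ act =
      TensorProduct.map act act ∘ₗ (TensorProduct.tensorTensorTensorComm k X X H H).toLinearMap
        ∘ₗ TensorProduct.map (Coalgebra.comul (R := k)) (Coalgebra.comul (R := k)))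
    (hcounit : ∀ (x : X) (g : H),
      Coalgebra.counit (R := k) (act (x ⊗ₜ g)) =
        Coalgebra.counit (R := k) x * Coalgebra.counit (R := k) g)
    (ν : X →ₗ[k] H)
    (hν_comul : (Coalgebra.comul (R := k) (A := H)) ∘ₗ ν =
      TensorProduct.map ν ν ∘ₗ Coalgebra.comul (R := k))
    (hν_counit : (Coalgebra.counit (R := k) (A := H)) ∘ₗ ν = Coalgebra.counit (R := k))
    (hν_aug : ∀ (x : X) (g : H), ν (act (x ⊗ₜ g)) = sandwich (ν x) (Coalgebra.comul (R := k) g)) :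
    rOne (X ⊗[k] X) (doubleR act ν) ∘ₗ LinearMap.lTensor (X ⊗[k] X) (doubleR act ν) ∘ₗ
        rOne (X ⊗[k] X) (doubleR act ν) =
      LinearMap.lTensor (X ⊗[k] X) (doubleR act ν) ∘ₗ rOne (X ⊗[k] X) (doubleR act ν) ∘ₗ
        LinearMap.lTensor (X ⊗[k] X) (doubleR act ν) := by
  have : Coalgebra.IsCocomm k H := ⟨LinearMap.ext hcocommH⟩
  simp only [doubleR_eq_rackR]
  exact rackR_yang_baxter (doubleAct act) (doubleAct_doubleAct act hact_mul)
    (comul_doubleAct act hcompat) (doubleNu ν) (comul_comp_doubleNu ν hν_comul)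
    (doubleNu_doubleAct act ν hν_aug)
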